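/- arXiv:2505.14614 — 2 statements merged into one kernel-verified Lean document; each statement's English description precedes it below -/
import Mathlib

section
/- Fix integers r, s ≥ 1, and nonnegative integers u₁,…,u_{r+s}, t₁,…,t_{r+s}. Then the formal power series W := ∑ over (n₁,…,n_r ≥ 0, d₁,…,d_r ≥ 1, n_{r+1},…,n_{r+s} ≥ 1, d_{r+1},…,d_{r+s} ≥ 1) with the constraint d₁+⋯+d_r = d_{r+1}+⋯+d_{r+s}, of ∏_{i=1}^{r+s} n_i^{u_i} d_i^{t_i} · q^{∑ n_i d_i}, can be written as a finite ℚ-linear combination of series of the same form but with the n-indices strictly decreasing: that is, of series ∑ over (ñ₁>⋯>ñ_f ≥ 0, d̃₁,…,d̃_f ≥ 1, ñ_{f+1}>⋯>ñ_{f+g} ≥ 1, d̃'s ≥ 1, d̃₁+⋯+d̃_f = d̃_{f+1}+⋯+d̃_{f+g}) of ∏ ñ_i^{ũ_i} d̃_i^{t̃_i} q^{∑ ñ_i d̃_i}, with ∑(ũ_i + t̃_i + 1) ≤ ∑(u_i + t_i + 1). Moreover, if all t_i ≥ 1 then all t̃_i ≥ 1 can be arranged. -/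
open Finset

/-- The unordered sum ∑_{n₁,…,n_r ≥ 0, n_{r+1},…,n_{r+s} ≥ 1, all dᵢ ≥ 1,
d₁+⋯+d_r = d_{r+1}+⋯+d_{r+s}} ∏ nᵢ^{uᵢ} dᵢ^{tᵢ} q^{∑ nᵢdᵢ} ∈ ℚ[[q]]. -/
noncomputable def unordSum (r s : ℕ) (u t : Fin (r + s) → ℕ) : PowerSeries ℚ :=
  PowerSeries.mk fun N =>
    ∑ p ∈ ((Fintype.piFinset fun _ : Fin (r + s) => Finset.range ((r + s) * N + 2)) ×ˢ
        (Fintype.piFinset fun _ : Fin (r + s) => Finset.range ((r + s) * N + 2))).filter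
      (fun p => (∀ i, 1 ≤ p.2 i) ∧ (∀ i : Fin (r + s), r ≤ (i : ℕ) → 1 ≤ p.1 i) ∧
        (∑ i ∈ Finset.univ.filter (fun i : Fin (r + s) => (i : ℕ) < r), p.2 i)
          = (∑ i ∈ Finset.univ.filter (fun i : Fin (r + s) => r ≤ (i : ℕ)), p.2 i) ∧
        (∑ i, p.1 i * p.2 i) = N),
      ∏ i, (p.1 i : ℚ) ^ (u i) * (p.2 i : ℚ) ^ (t i)

/-- The ordered sum ∑_{n₁>⋯>n_f ≥ 0, n_{f+1}>⋯>n_{f+g} ≥ 1, all dᵢ ≥ 1,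
d₁+⋯+d_f = d_{f+1}+⋯+d_{f+g}} ∏ nᵢ^{uᵢ} dᵢ^{tᵢ} q^{∑ nᵢdᵢ} ∈ ℚ[[q]]. -/
noncomputable def ordSum (f g : ℕ) (u t : Fin (f + g) → ℕ) : PowerSeries ℚ :=
  PowerSeries.mk fun N =>
    ∑ p ∈ ((Fintype.piFinset fun _ : Fin (f + g) => Finset.range ((f + g) * N + 2)) ×ˢ
        (Fintype.piFinset fun _ : Fin (f + g) => Finset.range ((f + g) * N + 2))).filter
      (fun p => (∀ i, 1 ≤ p.2 i) ∧ (∀ i : Fin (f + g), f ≤ (i : ℕ) → 1 ≤ p.1 i) ∧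
        (∀ i j : Fin (f + g), i < j → (j : ℕ) < f → p.1 j < p.1 i) ∧
        (∀ i j : Fin (f + g), i < j → f ≤ (i : ℕ) → p.1 j < p.1 i) ∧
        (∑ i ∈ Finset.univ.filter (fun i : Fin (f + g) => (i : ℕ) < f), p.2 i)
          = (∑ i ∈ Finset.univ.filter (fun i : Fin (f + g) => f ≤ (i : ℕ)), p.2 i) ∧
        (∑ i, p.1 i * p.2 i) = N),
      ∏ i, (p.1 i : ℚ) ^ (u i) * (p.2 i : ℚ) ^ (t i)

/-- The bi-bracket [s₁,…,s_ℓ; r₁,…,r_ℓ] = ∑_{u₁>⋯>u_ℓ>0, vᵢ>0}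
∏ (uᵢ^{rᵢ}/rᵢ!)(vᵢ^{sᵢ-1}/(sᵢ-1)!) q^{∑ uᵢvᵢ} ∈ ℚ[[q]]. -/
noncomputable def bibracket (l : ℕ) (s r : Fin l → ℕ) : PowerSeries ℚ :=
  PowerSeries.mk fun N =>
    ∑ p ∈ ((Fintype.piFinset fun _ : Fin l => Finset.range (N + 1)) ×ˢ
        (Fintype.piFinset fun _ : Fin l => Finset.range (N + 1))).filter
      (fun p => (∀ i, 1 ≤ p.1 i) ∧ (∀ i, 1 ≤ p.2 i) ∧
        (∀ i j : Fin l, i < j → p.1 j < p.1 i) ∧ (∑ i, p.1 i * p.2 i) = N),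
      ∏ i, ((p.1 i : ℚ) ^ (r i) / ((r i).factorial : ℚ)) *
        ((p.2 i : ℚ) ^ (s i - 1) / ((s i - 1).factorial : ℚ))

/-- The power series `∑_{d ≥ 1} d ^ k X ^ d`. -/
noncomputable def powSeries (k : ℕ) : PowerSeries ℚ :=
  PowerSeries.mk fun d => if d = 0 then 0 else (d : ℚ) ^ k

/-- The span of the series `powSeries k` with `a ≤ k < w`. -/
noncomputable def powSeriesSpan (a w : ℕ) : Submodule ℚ (PowerSeries ℚ) :=
  Submodule.span ℚ (powSeries '' Set.Ico a w)

theorem powSeries_mem {a w k : ℕ} (ha : a ≤ k) (hw : k < w) : powSeries k ∈ powSeriesSpan a w :=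
  Submodule.subset_span ⟨k, ⟨ha, hw⟩, rfl⟩

theorem powSeriesSpan_mono (a : ℕ) {w w' : ℕ} (h : w ≤ w') :
    powSeriesSpan a w ≤ powSeriesSpan a w' :=
  Submodule.span_mono (Set.image_mono (Set.Ico_subset_Ico_right h))

theorem X_mul_derivative_powSeries (k : ℕ) :
    PowerSeries.X * PowerSeries.derivative ℚ (powSeries k) = powSeries (k + 1) := by
  ext n
  cases n with
  | zero => simp [powSeries]
  | succ n =>
    rw [PowerSeries.coeff_succ_X_mul]
    simp [powSeries, PowerSeries.coeff_derivative, pow_succ]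

theorem X_mul_derivative_mem {a w : ℕ} {G : PowerSeries ℚ} (hG : G ∈ powSeriesSpan a w) :
    PowerSeries.X * PowerSeries.derivative ℚ G ∈ powSeriesSpan a (w + 1) := by
  refine Submodule.span_induction ?_ (by simp) ?_ ?_ hG
  · rintro _ ⟨k, hk, rfl⟩
    rw [X_mul_derivative_powSeries]
    exact powSeries_mem (hk.1.trans k.le_succ) (Nat.succ_lt_succ hk.2)
  · intro x y _ _ hx hy
    rw [map_add, mul_add]
    exact add_mem hx hy
  · intro c x _ hx
    rw [Derivation.map_smul, mul_smul_comm]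
    exact Submodule.smul_mem _ _ hx

theorem powSeries_mul_powSeries_zero (i : ℕ) :
    powSeries i * powSeries 0 =
      ∑ k ∈ range (i + 1), (bernoulli k * (i + 1).choose k / (i + 1)) • powSeries (i + 1 - k)
        - (0 : ℚ) ^ i • powSeries 0 := by
  ext n
  rw [PowerSeries.coeff_mul,
    Nat.sum_antidiagonal_eq_sum_range_succ
      (fun a b => PowerSeries.coeff a (powSeries i) * PowerSeries.coeff b (powSeries 0))]
  rcases Nat.eq_zero_or_pos n with rfl | hn
  · simp [powSeries]
  have h := sum_range_pow n i
  rw [sum_range_succ]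
  have h1 : ∑ k ∈ range n, PowerSeries.coeff k (powSeries i) *
      PowerSeries.coeff (n - k) (powSeries 0) = ∑ k ∈ range n, (k : ℚ) ^ i - 0 ^ i := by
    obtain ⟨m, rfl⟩ := Nat.exists_eq_succ_of_ne_zero hn.ne'
    rw [sum_range_succ', sum_range_succ']
    simp [powSeries]
    refine sum_congr rfl fun k hk => ?_
    have := mem_range.1 hk
    exact if_neg (by omega)
  rw [h1, h]
  simp only [powSeries, map_sub, map_sum, map_smul, PowerSeries.coeff_mk, hn.ne', if_false,
    smul_eq_mul, pow_zero, mul_one, Nat.sub_self, if_true, mul_zero, add_zero]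
  congr 1
  exact sum_congr rfl fun k _ => by ring

theorem powSeries_mul_mem {a : ℕ} (ha : a ≤ 1) (j : ℕ) :
    ∀ i, a ≤ i → powSeries i * powSeries j ∈ powSeriesSpan a (i + j + 2) := by
  induction j with
  | zero =>
    intro i hi
    rw [powSeries_mul_powSeries_zero]
    refine sub_mem (sum_mem fun k hk => Submodule.smul_mem _ _ ?_) ?_
    · have := mem_range.1 hk
      exact powSeries_mem (by omega) (by omega)
    · rcases Nat.eq_zero_or_pos i with rfl | h
      · exact Submodule.smul_mem _ _ (powSeries_mem hi (by omega))
      · simp [h.ne']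
  | succ j ih =>
    intro i hi
    have h : powSeries i * powSeries (j + 1) =
        PowerSeries.X * PowerSeries.derivative ℚ (powSeries i * powSeries j)
          - powSeries (i + 1) * powSeries j := by
      rw [Derivation.leibniz, ← X_mul_derivative_powSeries j, ← X_mul_derivative_powSeries i]
      simp only [smul_eq_mul]
      ring
    rw [h]
    refine sub_mem (X_mul_derivative_mem (ih i hi)) ?_
    convert ih (i + 1) (by omega) using 2
    ring

theorem mul_mem_powSeriesSpan {a w w' : ℕ} (ha : a ≤ 1) {F G : PowerSeries ℚ}
    (hF : F ∈ powSeriesSpan a w) (hG : G ∈ powSeriesSpan a w') :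
    F * G ∈ powSeriesSpan a (w + w') := by
  have h := Submodule.mul_mem_mul hF hG
  rw [powSeriesSpan, powSeriesSpan, Submodule.span_mul_span] at h
  refine Submodule.span_le.2 ?_ h
  rintro _ ⟨_, ⟨i, hi, rfl⟩, _, ⟨j, hj, rfl⟩, rfl⟩
  have := hi.2
  have := hj.2
  exact powSeriesSpan_mono a (by omega) (powSeries_mul_mem ha j i hi.1)

theorem prod_powSeries_mem {ι : Type*} {a : ℕ} (ha : a ≤ 1) {S : Finset ι} (hS : S.Nonempty)
    (t : ι → ℕ) (ht : ∀ i ∈ S, a ≤ t i) :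
    ∏ i ∈ S, powSeries (t i) ∈ powSeriesSpan a (∑ i ∈ S, (t i + 1)) := by
  induction hS using Finset.Nonempty.cons_induction with
  | singleton i => simpa using powSeries_mem (ht i (by simp)) (Nat.lt_succ_self _)
  | cons i S hi hS ih =>
    rw [prod_cons, sum_cons]
    exact mul_mem_powSeriesSpan ha (powSeries_mem (ht i (by simp)) (Nat.lt_succ_self _))
      (ih fun j hj => ht j (by simp [hj]))

theorem exists_coeff_of_mem_powSeriesSpan {a w : ℕ} {F : PowerSeries ℚ}
    (hF : F ∈ powSeriesSpan a w) :
    ∃ c : ℕ → ℚ, ∀ D, 1 ≤ D → PowerSeries.coeff D F = ∑ k ∈ Ico a w, c k * (D : ℚ) ^ k := by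
  rw [powSeriesSpan, ← coe_Ico, Submodule.mem_span_image_finset_iff_exists_fun] at hF
  obtain ⟨c, rfl⟩ := hF
  refine ⟨fun k => if h : k ∈ Ico a w then c ⟨k, h⟩ else 0, fun D hD => ?_⟩
  rw [← sum_attach (Ico a w)]
  simp only [map_sum, map_smul, powSeries, PowerSeries.coeff_mk, Nat.one_le_iff_ne_zero.1 hD,
    if_false, smul_eq_mul, univ_eq_attach, coe_mem, dif_pos]

theorem exists_surjective_fin_antitone {α : Type*} [Fintype α] (h : α → ℕ) :
    ∃ (f : ℕ) (σ : α → Fin f), Function.Surjective σ ∧ ∀ i j, h i < h j ↔ σ j < σ i := by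
  classical
  let T : Finset ℕᵒᵈ := univ.image fun i => OrderDual.toDual (h i)
  let e := T.orderIsoOfFin rfl
  refine ⟨T.card, fun i => e.symm ⟨OrderDual.toDual (h i), mem_image_of_mem _ (mem_univ i)⟩,
    fun j => ?_, fun i j => ?_⟩
  · obtain ⟨i, -, hi⟩ := mem_image.1 (e j).2
    exact ⟨i, by simp [hi]⟩
  · simp

theorem exists_block_surjection (r s : ℕ) (n : Fin (r + s) → ℕ) :
    ∃ (f g : ℕ) (σ : Fin (r + s) → Fin (f + g)), Function.Surjective σ ∧
      (∀ i, (σ i : ℕ) < f ↔ (i : ℕ) < r) ∧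
      ∀ i j : Fin (r + s), ((i : ℕ) < r ↔ (j : ℕ) < r) → (n i < n j ↔ σ j < σ i) := by
  obtain ⟨f, σ, hσ, hσn⟩ := exists_surjective_fin_antitone fun i => n (Fin.castAdd s i)
  obtain ⟨g, ρ, hρ, hρn⟩ := exists_surjective_fin_antitone fun i => n (Fin.natAdd r i)
  refine ⟨f, g, Fin.addCases (fun i => Fin.castAdd g (σ i)) (fun i => Fin.natAdd f (ρ i)),
    fun j => ?_, fun i => ?_, fun i j => ?_⟩
  · refine Fin.addCases (fun j => ?_) (fun j => ?_) j
    · obtain ⟨i, rfl⟩ := hσ j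
      exact ⟨Fin.castAdd s i, by simp⟩
    · obtain ⟨i, rfl⟩ := hρ j
      exact ⟨Fin.natAdd r i, by simp⟩
  · refine Fin.addCases (fun i => ?_) (fun i => ?_) i <;> simp
  · refine Fin.addCases (fun i => ?_) (fun i => ?_) i <;>
      refine Fin.addCases (fun j => ?_) (fun j => ?_) j <;>
      simp [hσn, hρn, Fin.lt_def, -Fin.val_fin_lt]
theorem prod_coeff_prod_fiber {ι κ : Type*} [Fintype ι] [Fintype κ] [DecidableEq ι]
    [DecidableEq κ] (σ : ι → κ) (t : ι → ℕ) (D : κ → ℕ) (E : Finset (ι → ℕ))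
    (hE : ∀ d, d ∈ E ↔ (∀ i, 1 ≤ d i) ∧ (fun j => ∑ i with σ i = j, d i) = D) :
    ∏ j, PowerSeries.coeff (D j) (∏ i with σ i = j, powSeries (t i)) =
      ∑ d ∈ E, ∏ i, (d i : ℚ) ^ t i := by
  simp only [PowerSeries.coeff_prod, prod_univ_sum]
  symm
  refine sum_of_injOn
    (fun d j => Finsupp.equivFunOnFinite.symm fun i => if σ i = j then d i else 0) ?_ ?_ ?_ ?_
  · intro d _ d' _ h
    funext i
    simpa using DFunLike.congr_fun (congr_fun h (σ i)) i
  · intro d hd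
    obtain ⟨-, rfl⟩ := (hE d).1 hd
    simp only [mem_coe, Fintype.mem_piFinset, mem_finsuppAntidiag]
    refine fun j => ⟨?_, fun i hi => ?_⟩
    · exact sum_congr rfl fun i hi => by simp [(mem_filter.1 hi).2]
    · simp at hi
      simp [hi.1]
  · intro x hx hxE
    simp only [Fintype.mem_piFinset, mem_finsuppAntidiag] at hx
    have hzero : ∃ i, x (σ i) i = 0 := by
      by_contra! hne
      refine hxE ⟨fun i => x (σ i) i, (hE _).2 ⟨fun i => Nat.one_le_iff_ne_zero.2 (hne i), ?_⟩, ?_⟩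
      · funext j
        rw [← (hx j).1]
        exact sum_congr rfl fun i hi => by rw [(mem_filter.1 hi).2]
      · funext j
        ext i
        by_cases hij : σ i = j
        · subst hij
          simp
        · have h0 : x j i = 0 := Finsupp.notMem_support_iff.1 fun h =>
            hij (mem_filter.1 ((hx j).2 h)).2
          simp [hij, h0]
    obtain ⟨i, hi⟩ := hzero
    exact prod_eq_zero (mem_univ (σ i)) (prod_eq_zero (i := i) (by simp) (by simp [hi, powSeries]))
  · intro d hd
    rw [← prod_fiberwise univ σ]
    refine prod_congr rfl fun j _ => prod_congr rfl fun i hi => ?_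
    have := Nat.one_le_iff_ne_zero.1 (((hE d).1 hd).1 i)
    simp [powSeries, (mem_filter.1 hi).2, this]

/-- The constraints on `(n, d)` common to the unordered and the ordered sums, where the first `r`
of the `l` indices form the first block. -/
def IsAdmissible (r : ℕ) {l : ℕ} (N : ℕ) (p : (Fin l → ℕ) × (Fin l → ℕ)) : Prop :=
  (∀ i, 1 ≤ p.2 i) ∧ (∀ i : Fin l, r ≤ (i : ℕ) → 1 ≤ p.1 i) ∧
    (∑ i ∈ univ.filter (fun i : Fin l => (i : ℕ) < r), p.2 i)
      = (∑ i ∈ univ.filter (fun i : Fin l => r ≤ (i : ℕ)), p.2 i) ∧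
    (∑ i, p.1 i * p.2 i) = N

theorem IsAdmissible.le {r l N : ℕ} {p : (Fin l → ℕ) × (Fin l → ℕ)} (h : IsAdmissible r N p)
    (i : Fin l) : p.1 i ≤ N ∧ p.2 i ≤ N := by
  obtain ⟨hd, hn, heq, rfl⟩ := h
  have hterm : p.1 i * p.2 i ≤ ∑ i, p.1 i * p.2 i :=
    single_le_sum (f := fun i => p.1 i * p.2 i) (fun _ _ => Nat.zero_le _) (mem_univ i)
  refine ⟨(Nat.le_mul_of_pos_right _ (hd i)).trans hterm, ?_⟩
  rcases lt_or_ge (i : ℕ) r with hi | hi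
  · calc
      p.2 i ≤ ∑ i ∈ univ.filter (fun i : Fin l => (i : ℕ) < r), p.2 i :=
        single_le_sum (fun _ _ => Nat.zero_le _) (by simpa using hi)
      _ = ∑ i ∈ univ.filter (fun i : Fin l => r ≤ (i : ℕ)), p.2 i := heq
      _ ≤ ∑ i ∈ univ.filter (fun i : Fin l => r ≤ (i : ℕ)), p.1 i * p.2 i :=
        sum_le_sum fun j hj => Nat.le_mul_of_pos_left _ (hn j (mem_filter.1 hj).2)
      _ ≤ _ := sum_le_sum_of_subset (filter_subset _ _)
  · exact (Nat.le_mul_of_pos_left _ (hn i hi)).trans hterm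

theorem IsAdmissible.mem_box {r l N : ℕ} {p : (Fin l → ℕ) × (Fin l → ℕ)}
    (h : IsAdmissible r N p) :
    p ∈ (Fintype.piFinset fun _ : Fin l => range (l * N + 2)) ×ˢ
      (Fintype.piFinset fun _ : Fin l => range (l * N + 2)) := by
  simp only [mem_product, Fintype.mem_piFinset, mem_range]
  refine ⟨fun i => ?_, fun i => ?_⟩ <;>
  · have := h.le i
    have := Nat.le_mul_of_pos_left N i.pos
    omega

/-- The order of `n` within each of the two blocks is reversed by `σ`. -/
def ReversesOrder (r : ℕ) {l m : ℕ} (σ : Fin l → Fin m) (n : Fin l → ℕ) : Prop :=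
  ∀ i j : Fin l, ((i : ℕ) < r ↔ (j : ℕ) < r) → (n i < n j ↔ σ j < σ i)

/-- `m` is strictly decreasing on each of the two blocks. -/
def BlockStrictAnti (f : ℕ) {l : ℕ} (m : Fin l → ℕ) : Prop :=
  ∀ i j : Fin l, ((i : ℕ) < f ↔ (j : ℕ) < f) → i < j → m j < m i

theorem blockStrictAnti_iff {f l : ℕ} {m : Fin l → ℕ} :
    BlockStrictAnti f m ↔ (∀ i j : Fin l, i < j → (j : ℕ) < f → m j < m i) ∧
      (∀ i j : Fin l, i < j → f ≤ (i : ℕ) → m j < m i) := by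
  refine ⟨fun h => ⟨fun i j hij hj => ?_, fun i j hij hi => ?_⟩, fun h i j hs hij => ?_⟩
  · exact h i j (by rw [Fin.lt_def] at hij; omega) hij
  · exact h i j (by rw [Fin.lt_def] at hij; omega) hij
  · by_cases hj : (j : ℕ) < f
    · exact h.1 i j hij hj
    · exact h.2 i j hij (by omega)

open Classical in
theorem coeff_ordSum (f g N : ℕ) (u t : Fin (f + g) → ℕ) :
    PowerSeries.coeff N (ordSum f g u t) =
      ∑ p ∈ ((Fintype.piFinset fun _ : Fin (f + g) => range ((f + g) * N + 2)) ×ˢ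
          (Fintype.piFinset fun _ : Fin (f + g) => range ((f + g) * N + 2))).filter
        (fun p => IsAdmissible f N p ∧ BlockStrictAnti f p.1),
        ∏ i, (p.1 i : ℚ) ^ u i * (p.2 i : ℚ) ^ t i := by
  rw [ordSum, PowerSeries.coeff_mk]
  refine sum_congr (filter_congr fun p _ => ?_) fun _ _ => rfl
  rw [blockStrictAnti_iff, IsAdmissible]
  tauto

section Collapse

variable {r f l m N : ℕ} {σ : Fin l → Fin m}

theorem isAdmissible_comp_iff (hσ : Function.Surjective σ)
    (hside : ∀ i, (σ i : ℕ) < f ↔ (i : ℕ) < r) (n : Fin m → ℕ) (d : Fin l → ℕ) :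
    IsAdmissible r N (n ∘ σ, d) ↔
      (∀ i, 1 ≤ d i) ∧ IsAdmissible f N (n, fun j => ∑ i with σ i = j, d i) := by
  have hside' : ∀ i, f ≤ (σ i : ℕ) ↔ r ≤ (i : ℕ) := fun i => by
    rw [← not_lt, ← not_lt, hside]
  have h1 : ∑ j ∈ univ.filter (fun j : Fin m => (j : ℕ) < f), ∑ i with σ i = j, d i
      = ∑ i ∈ univ.filter (fun i : Fin l => (i : ℕ) < r), d i := by
    rw [sum_fiberwise_eq_sum_filter]
    simp [hside]
  have h2 : ∑ j ∈ univ.filter (fun j : Fin m => f ≤ (j : ℕ)), ∑ i with σ i = j, d i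
      = ∑ i ∈ univ.filter (fun i : Fin l => r ≤ (i : ℕ)), d i := by
    rw [sum_fiberwise_eq_sum_filter]
    simp [hside']
  have h3 : ∑ j, n j * ∑ i with σ i = j, d i = ∑ i, n (σ i) * d i := by
    rw [← sum_fiberwise univ σ]
    refine sum_congr rfl fun j _ => ?_
    rw [mul_sum]
    exact sum_congr rfl fun i hi => by rw [(mem_filter.1 hi).2]
  have h4 : (∀ i : Fin l, r ≤ (i : ℕ) → 1 ≤ n (σ i)) ↔ ∀ j : Fin m, f ≤ (j : ℕ) → 1 ≤ n j := by
    rw [hσ.forall]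
    simp only [hside']
  have h5 : (∀ i, 1 ≤ d i) → ∀ j, 1 ≤ ∑ i with σ i = j, d i := fun hd j => by
    obtain ⟨i, rfl⟩ := hσ j
    exact (hd i).trans (single_le_sum (fun _ _ => Nat.zero_le _) (by simp))
  simp only [IsAdmissible, Function.comp_apply, h1, h2, h3, h4]
  tauto

theorem reversesOrder_comp_iff (hσ : Function.Surjective σ)
    (hside : ∀ i, (σ i : ℕ) < f ↔ (i : ℕ) < r) (n : Fin m → ℕ) :
    ReversesOrder r σ (n ∘ σ) ↔ BlockStrictAnti f n := by
  simp only [ReversesOrder, BlockStrictAnti, hσ.forall, hside, Function.comp_apply]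
  refine ⟨fun h i j hs hij => (h j i hs.symm).2 hij, fun h i j hs => ⟨fun hn => ?_, h j i hs.symm⟩⟩
  rcases lt_trichotomy (σ i) (σ j) with hlt | heq | hgt
  · exact absurd hn (h i j hs hlt).not_gt
  · simp [heq] at hn
  · exact hgt

theorem ReversesOrder.eq_of_eq (hside : ∀ i, (σ i : ℕ) < f ↔ (i : ℕ) < r) {n : Fin l → ℕ}
    (h : ReversesOrder r σ n) {i j : Fin l} (hij : σ i = σ j) : n i = n j := by
  have hs : (i : ℕ) < r ↔ (j : ℕ) < r := by rw [← hside, ← hside, hij]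
  refine le_antisymm (not_lt.1 fun hlt => ?_) (not_lt.1 fun hlt => ?_)
  · exact ((h j i hs.symm).1 hlt).ne hij
  · exact ((h i j hs).1 hlt).ne hij.symm

theorem sum_reversesOrder (hσ : Function.Surjective σ)
    (hside : ∀ i, (σ i : ℕ) < f ↔ (i : ℕ) < r) (u t : Fin l → ℕ)
    {A : Finset ((Fin l → ℕ) × (Fin l → ℕ))}
    (hA : ∀ p, p ∈ A ↔ IsAdmissible r N p ∧ ReversesOrder r σ p.1)
    {O : Finset ((Fin m → ℕ) × (Fin m → ℕ))}
    (hO : ∀ p, p ∈ O ↔ IsAdmissible f N p ∧ BlockStrictAnti f p.1) :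
    ∑ p ∈ A, ∏ i, (p.1 i : ℚ) ^ u i * (p.2 i : ℚ) ^ t i =
      ∑ p ∈ O, ∏ j, (p.1 j : ℚ) ^ (∑ i with σ i = j, u i) *
        PowerSeries.coeff (p.2 j) (∏ i with σ i = j, powSeries (t i)) := by
  let τ := Function.surjInv hσ
  have hτ : ∀ j, σ (τ j) = j := Function.surjInv_eq hσ
  let Φ : (Fin l → ℕ) × (Fin l → ℕ) → (Fin m → ℕ) × (Fin m → ℕ) :=
    fun p => (p.1 ∘ τ, fun j => ∑ i with σ i = j, p.2 i)
  have hcomp : ∀ p ∈ A, (p.1 ∘ τ) ∘ σ = p.1 := fun p hp => funext fun i =>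
    ((hA p).1 hp).2.eq_of_eq hside (hτ (σ i))
  have hcomp' : ∀ n : Fin m → ℕ, (n ∘ σ) ∘ τ = n := fun n => funext fun j => by simp [hτ]
  have hmaps : ∀ p ∈ A, Φ p ∈ O := fun p hp => by
    have h := (hA p).1 hp
    rw [← hcomp p hp, reversesOrder_comp_iff hσ hside] at h
    refine (hO _).2 ⟨((isAdmissible_comp_iff hσ hside (p.1 ∘ τ) p.2).1 ?_).2, h.2⟩
    rw [hcomp p hp]
    exact ((hA p).1 hp).1
  rw [← sum_fiberwise_of_maps_to hmaps]
  refine sum_congr rfl fun q hq => ?_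
  have hfst : ∀ p ∈ A.filter (Φ · = q), p.1 = q.1 ∘ σ := fun p hp => by
    obtain ⟨hpA, rfl⟩ := mem_filter.1 hp
    exact (hcomp p hpA).symm
  rw [prod_mul_distrib, prod_coeff_prod_fiber σ t q.2 ((A.filter (Φ · = q)).image Prod.snd),
    sum_image, mul_sum]
  · refine sum_congr rfl fun p hp => ?_
    rw [prod_mul_distrib, hfst p hp, ← prod_fiberwise univ σ fun i => ((q.1 ∘ σ) i : ℚ) ^ u i]
    congr 1
    refine prod_congr rfl fun j _ => ?_
    rw [← prod_pow_eq_pow_sum]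
    exact prod_congr rfl fun i hi => by rw [Function.comp_apply, (mem_filter.1 hi).2]
  · intro p hp p' hp' h
    exact Prod.ext ((hfst p hp).trans (hfst p' hp').symm) h
  · intro d
    rw [mem_image]
    constructor
    · rintro ⟨p, hp, rfl⟩
      obtain ⟨hpA, rfl⟩ := mem_filter.1 hp
      exact ⟨((hA p).1 hpA).1.1, rfl⟩
    · rintro ⟨hd, hD⟩
      refine ⟨(q.1 ∘ σ, d), mem_filter.2 ⟨(hA _).2 ⟨?_, ?_⟩, ?_⟩, rfl⟩
      · rw [isAdmissible_comp_iff hσ hside, hD]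
        exact ⟨hd, ((hO q).1 hq).1⟩
      · exact (reversesOrder_comp_iff hσ hside _).2 ((hO q).1 hq).2
      · exact Prod.ext (hcomp' q.1) hD

end Collapse

/-- The ordered sums of weight at most `w` all of whose exponents `t` are at least `a`. -/
def boundedOrdSums (a w : ℕ) : Set (PowerSeries ℚ) :=
  {F | ∃ (f g : ℕ) (u t : Fin (f + g) → ℕ),
    F = ordSum f g u t ∧ (∑ i, (u i + t i + 1)) ≤ w ∧ ∀ i, a ≤ t i}

theorem mk_sum_reversesOrder_mem {r l f g : ℕ} {σ : Fin l → Fin (f + g)}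
    (hσ : Function.Surjective σ) (hside : ∀ i, (σ i : ℕ) < f ↔ (i : ℕ) < r) (u t : Fin l → ℕ)
    {a : ℕ} (ha : a ≤ 1) (hat : ∀ i, a ≤ t i) {A : ℕ → Finset ((Fin l → ℕ) × (Fin l → ℕ))}
    (hA : ∀ N p, p ∈ A N ↔ IsAdmissible r N p ∧ ReversesOrder r σ p.1) :
    PowerSeries.mk (fun N => ∑ p ∈ A N, ∏ i, (p.1 i : ℚ) ^ u i * (p.2 i : ℚ) ^ t i) ∈
      Submodule.span ℚ (boundedOrdSums a (∑ i, (u i + t i + 1))) := by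
  let U : Fin (f + g) → ℕ := fun j => ∑ i with σ i = j, u i
  let w : Fin (f + g) → ℕ := fun j => ∑ i with σ i = j, (t i + 1)
  have hfiber : ∀ j, ∃ c : ℕ → ℚ, ∀ D, 1 ≤ D →
      PowerSeries.coeff D (∏ i with σ i = j, powSeries (t i)) =
        ∑ k ∈ Ico a (w j), c k * (D : ℚ) ^ k := fun j => by
    obtain ⟨i, rfl⟩ := hσ j
    exact exists_coeff_of_mem_powSeriesSpan
      (prod_powSeries_mem ha ⟨i, by simp⟩ t fun i _ => hat i)
  choose c hc using hfiber
  have hsum : PowerSeries.mk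
        (fun N => ∑ p ∈ A N, ∏ i, (p.1 i : ℚ) ^ u i * (p.2 i : ℚ) ^ t i) =
      ∑ k ∈ Fintype.piFinset fun j => Ico a (w j), (∏ j, c j (k j)) • ordSum f g U k := by
    classical
    ext N
    simp only [PowerSeries.coeff_mk, map_sum, map_smul, coeff_ordSum, smul_eq_mul, mul_sum]
    rw [sum_comm, sum_reversesOrder hσ hside u t (hA N) fun p =>
      mem_filter.trans (and_iff_right_iff_imp.2 fun h => h.1.mem_box)]
    refine sum_congr rfl fun p hp => ?_
    have hp1 := (mem_filter.1 hp).2.1.1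
    rw [prod_congr rfl fun j _ => by rw [hc j _ (hp1 j)], prod_mul_distrib, prod_univ_sum, mul_sum]
    refine sum_congr rfl fun k _ => ?_
    simp only [prod_mul_distrib, U]
    ring
  rw [hsum]
  refine sum_mem fun k hk => Submodule.smul_mem _ _ (Submodule.subset_span ⟨f, g, U, k, rfl, ?_, ?_⟩)
  · rw [← sum_fiberwise univ σ]
    refine sum_le_sum fun j _ => ?_
    have := (mem_Ico.1 (Fintype.mem_piFinset.1 hk j)).2
    simp only [w] at this
    simp only [U, add_assoc, sum_add_distrib] at this ⊢
    omega
  · exact fun j => (mem_Ico.1 (Fintype.mem_piFinset.1 hk j)).1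

theorem unordSum_mem_span (r s : ℕ) (u t : Fin (r + s) → ℕ) {a : ℕ} (ha : a ≤ 1)
    (hat : ∀ i, a ≤ t i) :
    unordSum r s u t ∈ Submodule.span ℚ (boundedOrdSums a (∑ i, (u i + t i + 1))) := by
  classical
  let pattern : (Fin (r + s) → ℕ) → Fin (r + s) → Fin (r + s) → Prop :=
    fun n i j => ((i : ℕ) < r ↔ (j : ℕ) < r) ∧ n i < n j
  let box (N : ℕ) := (Fintype.piFinset fun _ : Fin (r + s) => range ((r + s) * N + 2)) ×ˢ
    (Fintype.piFinset fun _ : Fin (r + s) => range ((r + s) * N + 2))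
  have hsum : unordSum r s u t = ∑ τ, PowerSeries.mk fun N =>
      ∑ p ∈ (box N).filter fun p => IsAdmissible r N p ∧ pattern p.1 = τ,
        ∏ i, (p.1 i : ℚ) ^ u i * (p.2 i : ℚ) ^ t i := by
    ext N
    simp only [unordSum, map_sum, PowerSeries.coeff_mk]
    simp only [← filter_filter (IsAdmissible r N)]
    rw [sum_fiberwise]
    exact sum_congr (filter_congr fun p _ => Iff.rfl) fun _ _ => rfl
  rw [hsum]
  refine sum_mem fun τ _ => ?_
  by_cases hτ : ∃ n, pattern n = τ
  · obtain ⟨n, rfl⟩ := hτ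
    obtain ⟨f, g, σ, hσ, hside, hn⟩ := exists_block_surjection r s n
    refine mk_sum_reversesOrder_mem hσ hside u t ha hat fun N p => ?_
    have hiff : pattern p.1 = pattern n ↔ ReversesOrder r σ p.1 := by
      simp only [pattern, funext_iff, eq_iff_iff, and_congr_right_iff, ReversesOrder]
      exact forall₂_congr fun i j => forall_congr' fun h => by rw [hn i j h]
    rw [mem_filter, hiff, and_iff_right_iff_imp]
    exact fun h => h.1.mem_box
  · push Not at hτ
    convert Submodule.zero_mem _
    ext N
    simp [hτ]

/-- Lemma 4.2: the unordered sum W is a finite ℚ-linear combination of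
ordered sums, with ∑(ũᵢ+t̃ᵢ+1) ≤ ∑(uᵢ+tᵢ+1), and with all t̃ᵢ ≥ 1 whenever all tᵢ ≥ 1. -/
theorem stmt11 (r s : ℕ) (hr : 1 ≤ r) (hs : 1 ≤ s) (u t : Fin (r + s) → ℕ) :
    ∃ (K : ℕ) (c : Fin K → ℚ) (f g : Fin K → ℕ)
      (u' : (κ : Fin K) → Fin (f κ + g κ) → ℕ) (t' : (κ : Fin K) → Fin (f κ + g κ) → ℕ),
      unordSum r s u t = ∑ κ, c κ • ordSum (f κ) (g κ) (u' κ) (t' κ) ∧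
      (∀ κ, (∑ i, (u' κ i + t' κ i + 1)) ≤ ∑ i, (u i + t i + 1)) ∧
      ((∀ i, 1 ≤ t i) → ∀ κ i, 1 ≤ t' κ i) := by
  let a := if ∀ i, 1 ≤ t i then 1 else 0
  have ha : a ≤ 1 := by
    simp only [a]
    split_ifs <;> simp
  have hat : ∀ i, a ≤ t i := fun i => by
    simp only [a]
    split_ifs with h
    exacts [h i, Nat.zero_le _]
  obtain ⟨K, c, F, hF⟩ := Submodule.mem_span_set'.1 (unordSum_mem_span r s u t ha hat)
  choose f g u' t' hord hw ht using fun κ => (F κ).2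
  refine ⟨K, c, f, g, u', t', ?_, hw, fun h κ i => ?_⟩
  · rw [← hF]
    exact sum_congr rfl fun κ _ => by rw [hord κ]
  · simpa [a, h] using ht κ i
end

section
/- Fix integers r, s ≥ 1 and nonnegative integers u₁,…,u_{r+s}, t₁,…,t_{r+s}. Then the formal q-series ∑ over (n₁>⋯>n_r ≥ 0, d₁,…,d_r ≥ 1, n_{r+1}>⋯>n_{r+s} ≥ 1, d_{r+1},…,d_{r+s} ≥ 1) with d₁+⋯+d_r = d_{r+1}+⋯+d_{r+s}, of ∏_{i=1}^{r+s} n_i^{u_i} d_i^{t_i} q^{∑ n_i d_i}, lies in the ℚ-span of bi-brackets; more precisely it is a finite ℚ-linear combination of bi-brackets [t'₁,…,t'_ℓ; u'₁,…,u'_ℓ] of weight ∑(t'_i+u'_i) at most ∑_{i=1}^{r+s}(u_i + t_i + 1), and if all t_i ≥ 1 then each bi-bracket occurring can be taken with t'₁ ≥ 2. -/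
open Finset

/-- The series `∑_m f(m) q^{mD}`; for `D = 0` it is the constant `f 0`. -/
noncomputable def dilate (D : ℕ) : (ℕ → ℚ) →ₗ[ℚ] PowerSeries ℚ where
  toFun f := PowerSeries.mk fun N => ∑ m ∈ range (N + 1), if m * D = N then f m else 0
  map_add' f g := by
    ext N
    simp only [PowerSeries.coeff_mk, map_add, ← sum_add_distrib, Pi.add_apply]
    exact sum_congr rfl fun m _ => by split_ifs <;> simp
  map_smul' c f := by
    ext N
    simp [mul_sum]

theorem coeff_dilate (D : ℕ) (f : ℕ → ℚ) (N : ℕ) :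
    PowerSeries.coeff N (dilate D f) = ∑ m ∈ range (N + 1), if m * D = N then f m else 0 :=
  PowerSeries.coeff_mk N fun N => ∑ m ∈ range (N + 1), if m * D = N then f m else 0

theorem dilate_zero (f : ℕ → ℚ) : dilate 0 f = PowerSeries.C (f 0) := by
  ext N
  rw [coeff_dilate, PowerSeries.coeff_C]
  rcases Nat.eq_zero_or_pos N with rfl | h
  · simp
  · simp [h.ne', h.ne]

theorem coeff_dilate_mul {D : ℕ} (hD : 1 ≤ D) (f : ℕ → ℚ) (G : PowerSeries ℚ) (N : ℕ) :
    PowerSeries.coeff N (dilate D f * G) =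
      ∑ m ∈ range (N + 1), if m * D ≤ N then f m * PowerSeries.coeff (N - m * D) G else 0 := by
  rw [PowerSeries.coeff_mul, Nat.sum_antidiagonal_eq_sum_range_succ
    (fun i j => PowerSeries.coeff i (dilate D f) * PowerSeries.coeff j G)]
  have h : ∀ k ∈ range N.succ,
      PowerSeries.coeff k (dilate D f) * PowerSeries.coeff (N - k) G =
      ∑ m ∈ range (N + 1), if m * D = k then f m * PowerSeries.coeff (N - m * D) G else 0 := by
    intro k hk
    rw [coeff_dilate, sum_mul]
    rw [← sum_subset (range_subset_range.2 (Nat.succ_le_of_lt (mem_range.1 hk) : k + 1 ≤ N + 1))]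
    · refine sum_congr rfl fun m _ => ?_
      split_ifs with e
      · rw [e]
      · simp
    · intro m _ hm
      rw [if_neg]
      rintro rfl
      exact hm (mem_range.2 (Nat.lt_succ_of_le (Nat.le_mul_of_pos_right m hD)))
  rw [sum_congr rfl h, sum_comm]
  refine sum_congr rfl fun m _ => ?_
  rw [sum_ite_eq]
  simp

/-- Additive convolution of arithmetic functions. -/
def addConv (f g : ℕ → ℚ) (c : ℕ) : ℚ := ∑ p ∈ antidiagonal c, f p.1 * g p.2

theorem coeff_dilate_of_pos {D : ℕ} (hD : 1 ≤ D) (f : ℕ → ℚ) (c : ℕ) :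
    PowerSeries.coeff (c * D) (dilate D f) = f c := by
  rw [coeff_dilate, sum_eq_single c]
  · simp
  · intro m _ hm
    rw [if_neg]
    exact fun h => hm (Nat.eq_of_mul_eq_mul_right hD h)
  · intro h
    exact absurd (mem_range.2 (Nat.lt_succ_of_le (Nat.le_mul_of_pos_right c hD))) h

theorem coeff_dilate_of_not_dvd {D N : ℕ} (h : ¬ D ∣ N) (f : ℕ → ℚ) :
    PowerSeries.coeff N (dilate D f) = 0 := by
  rw [coeff_dilate]
  exact sum_eq_zero fun m _ => if_neg fun e => h ⟨m, by rw [← e, mul_comm]⟩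

theorem dilate_mul (D : ℕ) (f g : ℕ → ℚ) :
    dilate D f * dilate D g = dilate D (addConv f g) := by
  rcases Nat.eq_zero_or_pos D with rfl | hD
  · simp [dilate_zero, addConv]
  ext N
  rw [coeff_dilate_mul hD]
  by_cases h : D ∣ N
  · obtain ⟨c, rfl⟩ := h
    rw [mul_comm D c, coeff_dilate_of_pos hD, addConv,
      Nat.sum_antidiagonal_eq_sum_range_succ (fun i j => f i * g j), ← sum_filter]
    have : (range (c * D + 1)).filter (fun m => m * D ≤ c * D) = range (c + 1) := by
      ext m
      simp only [mem_filter, mem_range, Nat.lt_succ_iff]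
      constructor
      · exact fun h => Nat.le_of_mul_le_mul_right h.2 hD
      · exact fun h => ⟨h.trans (Nat.le_mul_of_pos_right c hD), Nat.mul_le_mul_right D h⟩
    rw [this]
    refine sum_congr rfl fun m _ => ?_
    rw [← Nat.sub_mul, coeff_dilate_of_pos hD]
  · rw [coeff_dilate_of_not_dvd h]
    refine sum_eq_zero fun m _ => ?_
    split_ifs with hm
    · rw [coeff_dilate_of_not_dvd, mul_zero]
      intro h'
      exact h ((Nat.dvd_sub_iff_left hm (Dvd.intro_left m rfl)).1 h')
    · rfl

/-- The function `c ↦ c ^ s` restricted to `c ≥ ε`. -/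
def powFrom (ε s c : ℕ) : ℚ := if ε ≤ c then (c : ℚ) ^ s else 0

theorem powFrom_one (s : ℕ) :
    powFrom 1 s = powFrom 0 s - if s = 0 then Pi.single 0 1 else 0 := by
  funext c
  rcases Nat.eq_zero_or_pos c with rfl | h
  · by_cases hs : s = 0 <;> simp [powFrom, hs]
  · by_cases hs : s = 0 <;> simp [powFrom, hs, Nat.one_le_iff_ne_zero.1 h]

theorem dilate_single (D : ℕ) : dilate D (Pi.single 0 1) = 1 := by
  rcases Nat.eq_zero_or_pos D with rfl | hD
  · simp [dilate_zero]
  ext N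
  rw [coeff_dilate, PowerSeries.coeff_one, sum_eq_single 0]
  · simp [eq_comm]
  · intro m _ hm
    simp [hm]
  · simp

theorem addConv_powFrom_mem (s t : ℕ) :
    addConv (powFrom 0 s) (powFrom 1 t) ∈
      Submodule.span ℚ {f | ∃ k, 1 ≤ k ∧ k ≤ s + t + 1 ∧ f = powFrom 1 k} := by
  have key : addConv (powFrom 0 s) (powFrom 1 t) =
      ∑ i ∈ range (t + 1), ∑ j ∈ range (s + (t - i) + 1),
        ((-1) ^ (t - i) * (t.choose i : ℚ) *
          (bernoulli j * ((s + (t - i) + 1).choose j) / ((s + (t - i) : ℕ) + 1))) •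
          powFrom 1 (i + (s + (t - i) + 1 - j)) := by
    funext c
    simp only [addConv, Finset.sum_apply, Pi.smul_apply, smul_eq_mul]
    rw [Nat.sum_antidiagonal_eq_sum_range_succ (fun i j => powFrom 0 s i * powFrom 1 t j),
      sum_range_succ]
    rcases Nat.eq_zero_or_pos c with rfl | hc
    · simp [powFrom]
    have h1 : ∀ a ∈ range c, powFrom 0 s a * powFrom 1 t (c - a) =
        ∑ i ∈ range (t + 1), ((-1) ^ (t - i) * (t.choose i : ℚ)) * (c : ℚ) ^ i *
          (a : ℚ) ^ (s + (t - i)) := by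
      intro a ha
      have ha' := mem_range.1 ha
      simp only [powFrom, if_pos (Nat.zero_le a), if_pos (show 1 ≤ c - a by omega)]
      rw [Nat.cast_sub ha'.le, sub_eq_add_neg, add_pow, mul_sum]
      refine sum_congr rfl fun i _ => ?_
      rw [neg_pow, pow_add]
      ring
    rw [sum_congr rfl h1, sum_comm]
    simp only [powFrom, Nat.sub_self, nonpos_iff_eq_zero, one_ne_zero, if_false, mul_zero, add_zero,
      if_pos (show 1 ≤ c from hc)]
    refine sum_congr rfl fun i _ => ?_
    rw [← mul_sum, sum_range_pow, mul_sum]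
    refine sum_congr rfl fun j _ => ?_
    rw [pow_add (c : ℚ) i]
    push_cast
    ring
  rw [key]
  refine Submodule.sum_mem _ fun i hi => Submodule.sum_mem _ fun j hj => Submodule.smul_mem _ _ ?_
  refine Submodule.subset_span ⟨_, ?_, ?_, rfl⟩
  · have := mem_range.1 hj; omega
  · have := mem_range.1 hi; omega

/-- The sequence `k ↦ k^β ∑_{c ≥ ε} c^α q^{kc}` attached to the letter `x = (β, α)`. -/
noncomputable def letter (ε : ℕ) (x : ℕ × ℕ) (k : ℕ) : PowerSeries ℚ :=
  (k : ℚ) ^ x.1 • dilate k (powFrom ε x.2)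

/-- The summation operator `F ↦ (D ↦ ∑_{1 ≤ k < D} F k)`. -/
noncomputable def sumBelow : (ℕ → PowerSeries ℚ) →ₗ[ℚ] (ℕ → PowerSeries ℚ) where
  toFun F D := ∑ k ∈ Ico 1 D, F k
  map_add' F G := by
    funext D
    simp [sum_add_distrib]
  map_smul' c F := by
    funext D
    simp [smul_sum]

theorem sumBelow_apply (F : ℕ → PowerSeries ℚ) (D : ℕ) : sumBelow F D = ∑ k ∈ Ico 1 D, F k := rfl

/-- The sum over `D > k₁ > ⋯ > k_ℓ ≥ 1` of the product of the letters of a word. -/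
noncomputable def wordSum : List (ℕ × ℕ) → ℕ → PowerSeries ℚ
  | [] => 1
  | x :: L => sumBelow (letter 1 x * wordSum L)

/-- The weight of a word. -/
def weight : List (ℕ × ℕ) → ℕ
  | [] => 0
  | x :: L => x.1 + x.2 + 1 + weight L

/-- The span of letters of weight at most `w` with second exponent at least one. -/
def letterSpan (w : ℕ) : Submodule ℚ (ℕ → PowerSeries ℚ) :=
  Submodule.span ℚ {F | ∃ x : ℕ × ℕ, 1 ≤ x.2 ∧ x.1 + x.2 + 1 ≤ w ∧ F = letter 1 x}

/-- The span of word sums of weight at most `w`. -/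
def wordSpan (w : ℕ) : Submodule ℚ (ℕ → PowerSeries ℚ) :=
  Submodule.span ℚ {F | ∃ L, weight L ≤ w ∧ F = wordSum L}

/-- The span of the summands of word sums of weight at most `w`, where the outermost letter has its
second summation variable bounded below by `ε` and second exponent bounded below by `δ`. -/
def headSpan (ε δ w : ℕ) : Submodule ℚ (ℕ → PowerSeries ℚ) :=
  Submodule.span ℚ {F | ∃ (x : ℕ × ℕ) (L : List (ℕ × ℕ)), δ ≤ x.2 ∧ weight (x :: L) ≤ w ∧
    F = letter ε x * wordSum L}

theorem Submodule.mul_mem_of_span {R A : Type*} [CommSemiring R] [Semiring A] [Algebra R A]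
    {S T : Set A} {P : Submodule R A} (h : ∀ a ∈ S, ∀ b ∈ T, a * b ∈ P) {a b : A}
    (ha : a ∈ Submodule.span R S) (hb : b ∈ Submodule.span R T) : a * b ∈ P := by
  have hle : Submodule.span R S * Submodule.span R T ≤ P := by
    rw [Submodule.span_mul_span, Submodule.span_le]
    rintro _ ⟨a, ha, b, hb, rfl⟩
    exact h a ha b hb
  exact hle (Submodule.mul_mem_mul ha hb)

theorem letter_zero_mul_letter_one (x y : ℕ × ℕ) :
    letter 0 x * letter 1 y ∈ letterSpan (x.1 + x.2 + 1 + (y.1 + y.2 + 1)) := by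
  let T : (ℕ → ℚ) →ₗ[ℚ] (ℕ → PowerSeries ℚ) :=
    LinearMap.pi fun k => (k : ℚ) ^ (x.1 + y.1) • dilate k
  have h : letter 0 x * letter 1 y = T (addConv (powFrom 0 x.2) (powFrom 1 y.2)) := by
    funext k
    simp only [T, letter, Pi.mul_apply, LinearMap.pi_apply, LinearMap.smul_apply, ← dilate_mul,
      pow_add, smul_mul_smul_comm]
  rw [h]
  have := Submodule.mem_map_of_mem (f := T) (addConv_powFrom_mem x.2 y.2)
  rw [Submodule.map_span] at this
  refine Submodule.span_mono ?_ this
  rintro _ ⟨_, ⟨k, hk, hk', rfl⟩, rfl⟩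
  exact ⟨(x.1 + y.1, k), hk, by simp only; omega, rfl⟩

theorem letter_one_eq (x : ℕ × ℕ) :
    letter 1 x = letter 0 x - if x.2 = 0 then (fun k : ℕ => ((k : ℚ) ^ x.1) • (1 : PowerSeries ℚ)) else 0 := by
  funext k
  by_cases h : x.2 = 0
  · simp [letter, powFrom_one, h, smul_sub, dilate_single]
  · simp [letter, powFrom_one, h]

theorem pow_smul_letter (a ε : ℕ) (x : ℕ × ℕ) :
    (fun k : ℕ => ((k : ℚ) ^ a) • letter ε x k) = letter ε (a + x.1, x.2) := by
  funext k
  simp [letter, smul_smul, pow_add]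

theorem letter_mul_letter_mem (x y : ℕ × ℕ) :
    letter 1 x * letter 1 y ∈ Submodule.span ℚ
      {F | ∃ z : ℕ × ℕ, z.1 + z.2 + 1 ≤ x.1 + x.2 + 1 + (y.1 + y.2 + 1) ∧ F = letter 1 z} := by
  rw [letter_one_eq x, sub_mul]
  refine sub_mem ?_ ?_
  · refine Submodule.span_mono ?_ (letter_zero_mul_letter_one x y)
    rintro _ ⟨z, -, hz, rfl⟩
    exact ⟨z, hz, rfl⟩
  · split_ifs
    · refine Submodule.subset_span ⟨(x.1 + y.1, y.2), by simp only; omega, ?_⟩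
      rw [← pow_smul_letter]
      funext k
      simp
    · simp

theorem sumBelow_mul_sumBelow (F G : ℕ → PowerSeries ℚ) :
    sumBelow F * sumBelow G =
      sumBelow (F * sumBelow G) + sumBelow (G * sumBelow F) + sumBelow (F * G) := by
  funext D
  simp only [Pi.add_apply, Pi.mul_apply]
  induction D with
  | zero => simp [sumBelow_apply]
  | succ D ih =>
    rcases Nat.eq_zero_or_pos D with rfl | h
    · simp [sumBelow_apply]
    · have step : ∀ H, sumBelow H (D + 1) = sumBelow H D + H D := fun H => by
        simp only [sumBelow_apply]
        rw [sum_Ico_succ_top h]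
      simp only [step, Pi.mul_apply]
      linear_combination ih

theorem wordSpan_mono {w w' : ℕ} (h : w ≤ w') : wordSpan w ≤ wordSpan w' :=
  Submodule.span_mono fun _ ⟨L, hL, e⟩ => ⟨L, hL.trans h, e⟩

theorem sumBelow_mem {w : ℕ} {F : ℕ → PowerSeries ℚ} {S : Set (ℕ × ℕ)} {v : ℕ}
    (hS : ∀ x ∈ S, x.1 + x.2 + 1 ≤ v) {G : ℕ → PowerSeries ℚ}
    (hF : F ∈ Submodule.span ℚ {F | ∃ x ∈ S, F = letter 1 x})
    (hG : G ∈ wordSpan w) : sumBelow (F * G) ∈ wordSpan (v + w) := by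
  refine Submodule.mul_mem_of_span (P := (wordSpan (v + w)).comap sumBelow) ?_ hF hG
  rintro _ ⟨x, hx, rfl⟩ _ ⟨L, hL, rfl⟩
  have := hS x hx
  exact Submodule.subset_span ⟨x :: L, by simp only [weight]; omega, rfl⟩

theorem letter_mem_span (x : ℕ × ℕ) :
    letter 1 x ∈ Submodule.span ℚ {F | ∃ z ∈ ({x} : Set (ℕ × ℕ)), F = letter 1 z} :=
  Submodule.subset_span ⟨x, rfl, rfl⟩

theorem wordSum_mul_mem : ∀ L M : List (ℕ × ℕ),
    wordSum L * wordSum M ∈ wordSpan (weight L + weight M)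
  | [], M => by
    refine Submodule.subset_span ⟨M, by simp [weight], ?_⟩
    rw [wordSum, one_mul]
  | x :: L, [] => by
    refine Submodule.subset_span ⟨x :: L, by simp [weight], ?_⟩
    rw [wordSum.eq_1, mul_one]
  | x :: L, y :: M => by
    have h1 := sumBelow_mem (fun z (hz : z ∈ ({x} : Set _)) => by rw [hz]) (letter_mem_span x)
      (wordSum_mul_mem L (y :: M))
    have h2 := sumBelow_mem (fun z (hz : z ∈ ({y} : Set _)) => by rw [hz]) (letter_mem_span y)
      (wordSum_mul_mem M (x :: L))
    have h3 := sumBelow_mem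
      (S := {z | z.1 + z.2 + 1 ≤ x.1 + x.2 + 1 + (y.1 + y.2 + 1)}) (fun z hz => hz)
      (letter_mul_letter_mem x y) (wordSum_mul_mem L M)
    have e : wordSum (x :: L) * wordSum (y :: M) =
        sumBelow (letter 1 x * (wordSum L * wordSum (y :: M))) +
        sumBelow (letter 1 y * (wordSum M * wordSum (x :: L))) +
        sumBelow (letter 1 x * letter 1 y * (wordSum L * wordSum M)) := by
      rw [wordSum, wordSum, sumBelow_mul_sumBelow, mul_assoc, mul_assoc, mul_mul_mul_comm]
    rw [e]
    refine add_mem (add_mem ?_ ?_) ?_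
    · refine wordSpan_mono ?_ h1
      simp only [weight]; omega
    · refine wordSpan_mono ?_ h2
      simp only [weight]; omega
    · refine wordSpan_mono ?_ h3
      simp only [weight]; omega
termination_by L M => L.length + M.length

theorem headSpan_mul_headSpan {w w' : ℕ} {F G : ℕ → PowerSeries ℚ} (hF : F ∈ headSpan 0 0 w)
    (hG : G ∈ headSpan 1 0 w') : F * G ∈ headSpan 1 1 (w + w') := by
  refine Submodule.mul_mem_of_span ?_ hF hG
  rintro _ ⟨x, L, -, hx, rfl⟩ _ ⟨y, M, -, hy, rfl⟩
  rw [mul_mul_mul_comm]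
  refine Submodule.mul_mem_of_span ?_ (letter_zero_mul_letter_one x y) (wordSum_mul_mem L M)
  rintro _ ⟨z, hz, hz', rfl⟩ _ ⟨K, hK, rfl⟩
  simp only [weight] at hx hy
  exact Submodule.subset_span ⟨z, K, hz, by simp only [weight]; omega, rfl⟩

theorem letter_mul_mem_headSpan (ε : ℕ) (x : ℕ × ℕ) {w v : ℕ} {F : ℕ → PowerSeries ℚ}
    (hF : F ∈ wordSpan w) (hv : x.1 + x.2 + 1 + w ≤ v) :
    letter ε x * F ∈ headSpan ε 0 v := by
  refine Submodule.mul_mem_of_span (S := {letter ε x}) ?_ (Submodule.mem_span_singleton_self _) hF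
  rintro _ rfl _ ⟨L, hL, rfl⟩
  exact Submodule.subset_span ⟨x, L, Nat.zero_le _, by simp only [weight]; omega, rfl⟩

theorem sumBelow_pow_smul_mem (a : ℕ) {w : ℕ} {F : ℕ → PowerSeries ℚ} (hF : F ∈ headSpan 1 0 w) :
    sumBelow (fun k => ((k : ℚ) ^ a) • F k) ∈ wordSpan (a + w) := by
  let T : (ℕ → PowerSeries ℚ) →ₗ[ℚ] (ℕ → PowerSeries ℚ) :=
    sumBelow ∘ₗ LinearMap.pi fun k => ((k : ℚ) ^ a) • LinearMap.proj k
  have h : headSpan 1 0 w ≤ (wordSpan (a + w)).comap T := by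
    refine Submodule.span_le.2 ?_
    rintro _ ⟨x, L, -, hx, rfl⟩
    refine Submodule.subset_span ⟨(a + x.1, x.2) :: L, ?_, ?_⟩
    · simp only [weight] at hx ⊢; omega
    · rw [wordSum, ← pow_smul_letter]
      change sumBelow _ = sumBelow _
      congr 1
      funext k
      simp
  exact h hF

/-- Pairs `(n, d)` with `n₁ > ⋯ > n_r ≥ ε`, `dᵢ ≥ 1`, `∑ dᵢ = D` and `∑ nᵢ dᵢ = N`. -/
def chains (ε r D N : ℕ) : Finset ((Fin r → ℕ) × (Fin r → ℕ)) :=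
  ((Fintype.piFinset fun _ : Fin r => range (N + 1)) ×ˢ
    (Fintype.piFinset fun _ : Fin r => range (D + 1))).filter
    fun p => (∀ i, 1 ≤ p.2 i) ∧ (∀ i, ε ≤ p.1 i) ∧ (∀ i j, i < j → p.1 j < p.1 i) ∧
      ∑ i, p.2 i = D ∧ ∑ i, p.1 i * p.2 i = N

theorem mem_chains {ε r D N : ℕ} {p : (Fin r → ℕ) × (Fin r → ℕ)} :
    p ∈ chains ε r D N ↔ (∀ i, 1 ≤ p.2 i) ∧ (∀ i, ε ≤ p.1 i) ∧ (∀ i j, i < j → p.1 j < p.1 i) ∧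
      ∑ i, p.2 i = D ∧ ∑ i, p.1 i * p.2 i = N := by
  simp only [chains, mem_filter, mem_product, Fintype.mem_piFinset, mem_range, Nat.lt_succ_iff,
    and_iff_right_iff_imp]
  rintro ⟨h1, -, -, h4, h5⟩
  refine ⟨fun i => ?_, fun i => ?_⟩
  · rw [← h5]
    exact (Nat.le_mul_of_pos_right _ (h1 i)).trans
      (single_le_sum (f := fun i => p.1 i * p.2 i) (fun _ _ => Nat.zero_le _) (mem_univ i))
  · rw [← h4]
    exact single_le_sum (f := p.2) (fun _ _ => Nat.zero_le _) (mem_univ i)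

theorem sum_chains_succ (ε r D N : ℕ) (g : (Fin (r + 1) → ℕ) → (Fin (r + 1) → ℕ) → ℚ) :
    ∑ p ∈ chains ε (r + 1) D N, g p.1 p.2 =
      ∑ x ∈ (range (N + 1) ×ˢ range D).filter (fun x => ε ≤ x.1 ∧ x.1 * D ≤ N),
        ∑ p ∈ chains 1 r x.2 (N - x.1 * D),
          g (Fin.snoc (fun i => p.1 i + x.1) x.1) (Fin.snoc p.2 (D - x.2)) := by
  rw [sum_sigma']
  symm
  refine sum_bij'
    (i := fun y _ => ((Fin.snoc (fun i => y.2.1 i + y.1.1) y.1.1 : Fin (r + 1) → ℕ),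
      (Fin.snoc y.2.2 (D - y.1.2) : Fin (r + 1) → ℕ)))
    (j := fun p _ => ⟨(p.1 (Fin.last r), ∑ i : Fin r, p.2 i.castSucc),
      (fun i => p.1 i.castSucc - p.1 (Fin.last r), fun i => p.2 i.castSucc)⟩) ?_ ?_ ?_ ?_ ?_
  · rintro ⟨⟨a, D'⟩, n, d⟩ h
    simp only [mem_sigma, mem_filter, mem_product, mem_range, mem_chains] at h
    obtain ⟨⟨⟨-, hD⟩, ha, haN⟩, hd, hn, hanti, hsum, hN⟩ := h
    rw [mem_chains]
    refine ⟨?_, ?_, ?_, ?_, ?_⟩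
    · intro i
      induction i using Fin.lastCases with
      | last => simp; omega
      | cast i => simpa using hd i
    · intro i
      induction i using Fin.lastCases with
      | last => simpa using ha
      | cast i => simp; omega
    · intro i j hij
      induction j using Fin.lastCases with
      | last =>
        induction i using Fin.lastCases with
        | last => exact absurd hij (lt_irrefl _)
        | cast i => simpa [Nat.pos_iff_ne_zero, Nat.one_le_iff_ne_zero] using hn i
      | cast j =>
        induction i using Fin.lastCases with
        | last => exact absurd hij (not_lt.2 (Fin.le_last _))
        | cast i => simpa using hanti i j (by simpa using hij)
    · simp only [Fin.sum_univ_castSucc, Fin.snoc_castSucc, Fin.snoc_last, hsum]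
      omega
    · simp only [Fin.sum_univ_castSucc, Fin.snoc_castSucc, Fin.snoc_last, add_mul,
        sum_add_distrib, hN, ← mul_sum, hsum]
      rw [add_assoc, ← mul_add, Nat.add_sub_cancel' hD.le, Nat.sub_add_cancel haN]
  · rintro ⟨n, d⟩ h
    rw [mem_chains] at h
    obtain ⟨hd, hn, hanti, hsum, hN⟩ := h
    simp only [Fin.sum_univ_castSucc] at hsum hN hd hn hanti
    have hlast := hd (Fin.last r)
    have hlt : ∀ i : Fin r, n (Fin.last r) < n i.castSucc := fun i =>
      hanti _ _ (Fin.castSucc_lt_last i)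
    have hkey : ∑ i : Fin r, (n i.castSucc - n (Fin.last r)) * d i.castSucc +
        n (Fin.last r) * D = N := by
      rw [← hN, ← hsum, mul_add, ← add_assoc, mul_sum, ← sum_add_distrib]
      congr 1
      refine sum_congr rfl fun i _ => ?_
      rw [← add_mul, Nat.sub_add_cancel (hlt i).le]
    have hle : n (Fin.last r) ≤ n (Fin.last r) * D := Nat.le_mul_of_pos_right _ (by omega)
    simp only [mem_sigma, mem_filter, mem_product, mem_range, mem_chains]
    refine ⟨⟨⟨by omega, by omega⟩, hn _, by omega⟩, fun i => hd _, fun i => ?_, fun i j hij => ?_,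
      trivial, by omega⟩
    · have := hlt i
      omega
    · have := hanti i.castSucc j.castSucc (by simpa using hij)
      have := hlt j
      omega
  · rintro ⟨⟨a, D'⟩, n, d⟩ h
    simp only [mem_sigma, mem_filter, mem_product, mem_range, mem_chains] at h
    simp [h.2.2.2.2.1]
  · rintro ⟨n, d⟩ h
    rw [mem_chains] at h
    obtain ⟨hd, hn, hanti, hsum, hN⟩ := h
    simp only [Fin.sum_univ_castSucc] at hsum hanti
    refine Prod.ext ?_ ?_
    · funext i
      induction i using Fin.lastCases with
      | last => simp
      | cast i =>
        have := hanti _ _ (Fin.castSucc_lt_last i)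
        simp only [Fin.snoc_castSucc]
        omega
    · funext i
      induction i using Fin.lastCases with
      | last => simp only [Fin.snoc_last]; omega
      | cast i => simp
  · intros
    rfl

/-- The generating series of chains of total multiplicity `D`, weighted by monomials. -/
noncomputable def block (ε r : ℕ) (u t : Fin r → ℕ) (D : ℕ) : PowerSeries ℚ :=
  PowerSeries.mk fun N => ∑ p ∈ chains ε r D N, ∏ i, (p.1 i : ℚ) ^ u i * (p.2 i : ℚ) ^ t i

theorem coeff_block (ε r : ℕ) (u t : Fin r → ℕ) (D N : ℕ) :
    PowerSeries.coeff N (block ε r u t D) =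
      ∑ p ∈ chains ε r D N, ∏ i, (p.1 i : ℚ) ^ u i * (p.2 i : ℚ) ^ t i :=
  PowerSeries.coeff_mk N _

theorem chains_zero (ε D N : ℕ) : chains ε 0 D N = if D = 0 ∧ N = 0 then univ else ∅ := by
  ext p
  rw [mem_chains]
  split_ifs with h
  · simp [h]
  · simpa [eq_comm] using h

theorem block_zero (ε : ℕ) (u t : Fin 0 → ℕ) (D : ℕ) :
    block ε 0 u t D = if D = 0 then 1 else 0 := by
  ext N
  rw [coeff_block, chains_zero]
  by_cases hD : D = 0 <;> by_cases hN : N = 0 <;> simp [hD, hN, PowerSeries.coeff_one]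

theorem block_succ_zero (ε r : ℕ) (u t : Fin (r + 1) → ℕ) : block ε (r + 1) u t 0 = 0 := by
  ext N
  rw [coeff_block, map_zero]
  refine sum_eq_zero fun p hp => ?_
  obtain ⟨h1, -, -, h4, -⟩ := mem_chains.1 hp
  have := h1 0
  have := sum_eq_zero_iff.1 h4 0 (mem_univ _)
  omega

theorem prod_add_pow {ι : Type*} [Fintype ι] [DecidableEq ι] (n : ι → ℚ) (a : ℚ) (u : ι → ℕ) :
    ∏ i, (n i + a) ^ u i = ∑ v ∈ Fintype.piFinset fun i => range (u i + 1),
      (∏ i, ((u i).choose (v i) : ℚ)) * a ^ (∑ i, (u i - v i)) * ∏ i, n i ^ v i := by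
  simp only [add_pow, prod_univ_sum, ← prod_pow_eq_pow_sum, ← prod_mul_distrib]
  refine sum_congr rfl fun v _ => ?_
  exact prod_congr rfl fun i _ => by ring

theorem block_succ (ε r : ℕ) (u t : Fin (r + 1) → ℕ) {D : ℕ} (hD : 1 ≤ D) :
    block ε (r + 1) u t D =
      ∑ v ∈ Fintype.piFinset fun i : Fin r => range (u i.castSucc + 1),
        (∏ i : Fin r, ((u i.castSucc).choose (v i) : ℚ)) •
        (dilate D (powFrom ε (u (Fin.last r) + ∑ i : Fin r, (u i.castSucc - v i))) *
          ∑ k ∈ range D, ((D : ℚ) - k) ^ t (Fin.last r) •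
            block 1 r v (fun i => t i.castSucc) k) := by
  ext N
  simp only [map_sum, map_smul, coeff_dilate_mul hD, smul_eq_mul]
  rw [coeff_block, sum_chains_succ ε r D N
    (fun n d => ∏ i, (n i : ℚ) ^ u i * (d i : ℚ) ^ t i), sum_filter, sum_product]
  simp only [mul_sum]
  conv_rhs => rw [sum_comm]
  refine sum_congr rfl fun a _ => ?_
  by_cases ha : ε ≤ a ∧ a * D ≤ N
  · simp only [ha, and_self, if_true, powFrom, mul_sum, coeff_block]
    rw [sum_comm]
    refine sum_congr rfl fun k hk => ?_
    rw [sum_comm]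
    refine sum_congr rfl fun p _ => ?_
    simp only [Fin.prod_univ_castSucc, Fin.snoc_castSucc, Fin.snoc_last, Nat.cast_add,
      prod_mul_distrib, prod_add_pow, Nat.cast_sub (mem_range.1 hk).le, sum_mul]
    refine sum_congr rfl fun v _ => ?_
    rw [pow_add]
    ring
  · rw [sum_eq_zero, sum_eq_zero]
    · intro v _
      by_cases h : a * D ≤ N
      · have : ¬ ε ≤ a := fun h' => ha ⟨h', h⟩
        simp [powFrom, this]
      · simp [h]
    · intro k _
      rw [if_neg ha]

theorem exists_headSpan_eq_block (r : ℕ) : ∀ (ε : ℕ) (u t : Fin (r + 1) → ℕ),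
    ∃ F ∈ headSpan ε 0 (∑ i, (u i + t i + 1)), ∀ D, 1 ≤ D → block ε (r + 1) u t D = F D := by
  induction r with
  | zero =>
    intro ε u t
    refine ⟨letter ε (t 0, u 0) * wordSum [], Submodule.subset_span
      ⟨(t 0, u 0), [], Nat.zero_le _, ?_, rfl⟩, fun D hD => ?_⟩
    · simp [weight]; omega
    · rw [block_succ ε 0 u t hD]
      obtain ⟨E, rfl⟩ : ∃ E, D = E + 1 := ⟨D - 1, by omega⟩
      simp [block_zero, letter, wordSum]
  | succ r ih =>
    intro ε u t
    choose F hF hFeq using ih 1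
    let T := t (Fin.last (r + 1))
    let t' : Fin (r + 1) → ℕ := fun i => t i.castSucc
    refine ⟨∑ v ∈ Fintype.piFinset fun i : Fin (r + 1) => range (u i.castSucc + 1),
      (∏ i : Fin (r + 1), ((u i.castSucc).choose (v i) : ℚ)) •
      ∑ j ∈ range (T + 1), ((-1) ^ (T - j) * (T.choose j : ℚ)) •
        (letter ε (j, u (Fin.last _) + ∑ i : Fin (r + 1), (u i.castSucc - v i)) *
          sumBelow (fun k => ((k : ℚ) ^ (T - j)) • F v t' k)), ?_, ?_⟩
    · refine Submodule.sum_mem _ fun v hv => Submodule.smul_mem _ _ <|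
        Submodule.sum_mem _ fun j hj => Submodule.smul_mem _ _ ?_
      refine letter_mul_mem_headSpan ε _ (sumBelow_pow_smul_mem _ (hF v t')) ?_
      have h1 : ∑ i : Fin (r + 1), (u i.castSucc - v i) + ∑ i, (v i + t' i + 1) =
          ∑ i : Fin (r + 1), (u i.castSucc + t i.castSucc + 1) := by
        rw [← sum_add_distrib]
        refine sum_congr rfl fun i _ => ?_
        have := mem_range.1 (Fintype.mem_piFinset.1 hv i)
        simp only [t']
        omega
      have := mem_range.1 hj
      rw [Fin.sum_univ_castSucc (fun i => u i + t i + 1), ← h1]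
      simp only [T] at this ⊢
      omega
    · intro D hD
      rw [block_succ ε (r + 1) u t hD, Finset.sum_apply]
      refine sum_congr rfl fun v _ => ?_
      rw [Pi.smul_apply, Finset.sum_apply]
      congr 1
      have hsum : ∑ k ∈ range D, ((D : ℚ) - k) ^ T • block 1 (r + 1) v t' k =
          ∑ k ∈ Ico 1 D, ((D : ℚ) - k) ^ T • F v t' k := by
        rw [range_eq_Ico, sum_eq_sum_Ico_succ_bot hD, block_succ_zero, smul_zero, zero_add]
        exact sum_congr rfl fun k hk => by rw [hFeq v t' k (mem_Ico.1 hk).1]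
      rw [hsum]
      simp only [Pi.smul_apply, Pi.mul_apply, letter, sumBelow_apply, mul_sum, smul_sum,
        sub_eq_add_neg, add_pow, sum_smul]
      rw [sum_comm]
      refine sum_congr rfl fun j _ => sum_congr rfl fun k _ => ?_
      rw [neg_pow (k : ℚ)]
      simp only [mul_smul_comm, smul_mul_assoc, smul_smul]
      congr 1
      ring

theorem sum_filter_val_lt (r s : ℕ) (d : Fin (r + s) → ℕ) :
    ∑ i ∈ univ.filter (fun i : Fin (r + s) => (i : ℕ) < r), d i =
      ∑ i : Fin r, d (Fin.castAdd s i) := by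
  rw [sum_filter, Fin.sum_univ_add]
  simp

theorem sum_filter_le_val (r s : ℕ) (d : Fin (r + s) → ℕ) :
    ∑ i ∈ univ.filter (fun i : Fin (r + s) => r ≤ (i : ℕ)), d i =
      ∑ i : Fin s, d (Fin.natAdd r i) := by
  rw [sum_filter, Fin.sum_univ_add]
  simp

theorem mem_ordIndex {r s : ℕ} (hr : 1 ≤ r) {N : ℕ}
    {p : (Fin (r + s) → ℕ) × (Fin (r + s) → ℕ)} :
    p ∈ ((Fintype.piFinset fun _ : Fin (r + s) => Finset.range ((r + s) * N + 2)) ×ˢ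
        (Fintype.piFinset fun _ : Fin (r + s) => Finset.range ((r + s) * N + 2))).filter
      (fun p => (∀ i, 1 ≤ p.2 i) ∧ (∀ i : Fin (r + s), r ≤ (i : ℕ) → 1 ≤ p.1 i) ∧
        (∀ i j : Fin (r + s), i < j → (j : ℕ) < r → p.1 j < p.1 i) ∧
        (∀ i j : Fin (r + s), i < j → r ≤ (i : ℕ) → p.1 j < p.1 i) ∧
        (∑ i ∈ Finset.univ.filter (fun i : Fin (r + s) => (i : ℕ) < r), p.2 i)
          = (∑ i ∈ Finset.univ.filter (fun i : Fin (r + s) => r ≤ (i : ℕ)), p.2 i) ∧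
        (∑ i, p.1 i * p.2 i) = N) ↔
    (∀ i, 1 ≤ p.2 i) ∧ (∀ i : Fin s, 1 ≤ p.1 (Fin.natAdd r i)) ∧
      (∀ i j : Fin r, i < j → p.1 (Fin.castAdd s j) < p.1 (Fin.castAdd s i)) ∧
      (∀ i j : Fin s, i < j → p.1 (Fin.natAdd r j) < p.1 (Fin.natAdd r i)) ∧
      ∑ i : Fin r, p.2 (Fin.castAdd s i) = ∑ i : Fin s, p.2 (Fin.natAdd r i) ∧
      ∑ i : Fin r, p.1 (Fin.castAdd s i) * p.2 (Fin.castAdd s i) +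
        ∑ i : Fin s, p.1 (Fin.natAdd r i) * p.2 (Fin.natAdd r i) = N := by
  obtain ⟨n, d⟩ := p
  simp only [mem_filter, mem_product, Fintype.mem_piFinset, mem_range, sum_filter_val_lt,
    sum_filter_le_val]
  rw [Fin.sum_univ_add]
  constructor
  · rintro ⟨-, hd, hn, hanti, hanti', hsum, hN⟩
    exact ⟨hd, fun i => hn _ (by simp), fun i j hij => hanti _ _ hij (by simp),
      fun i j hij => hanti' _ _ (by simpa using hij) (by simp), hsum, hN⟩
  · rintro ⟨hd, hn, hanti, hanti', hsum, hN⟩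
    have hNle : N ≤ (r + s) * N := Nat.le_mul_of_pos_left N (by omega)
    have hle : ∑ i : Fin s, d (Fin.natAdd r i) ≤ N := by
      refine (sum_le_sum fun i _ => Nat.le_mul_of_pos_left _ (hn i)).trans ?_
      omega
    refine ⟨⟨fun i => ?_, fun i => ?_⟩, hd, ?_, ?_, ?_, hsum, hN⟩
    · have h1 : n i ≤ n i * d i := Nat.le_mul_of_pos_right _ (hd i)
      have h2 := single_le_sum (f := fun i => n i * d i) (fun _ _ => Nat.zero_le _) (mem_univ i)
      rw [Fin.sum_univ_add, hN] at h2
      omega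
    · have h1 : d i ≤ N := by
        induction i using Fin.addCases with
        | left i =>
          have := single_le_sum (f := fun i : Fin r => d (Fin.castAdd s i))
            (fun _ _ => Nat.zero_le _) (mem_univ i)
          omega
        | right i =>
          have := single_le_sum (f := fun i : Fin s => d (Fin.natAdd r i))
            (fun _ _ => Nat.zero_le _) (mem_univ i)
          omega
      omega
    · intro i
      induction i using Fin.addCases with
      | left i => exact fun h => absurd i.isLt (not_lt.2 (by simpa using h))
      | right i => exact fun _ => hn i
    · intro i j hij hj
      have hi : (i : ℕ) < r := lt_trans hij hj
      exact hanti ⟨i, hi⟩ ⟨j, hj⟩ hij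
    · intro i j hij hi
      induction i using Fin.addCases with
      | left i => exact absurd i.isLt (not_lt.2 (by simpa using hi))
      | right i =>
        induction j using Fin.addCases with
        | left j =>
          have := j.isLt
          simp only [Fin.lt_def, Fin.val_castAdd, Fin.val_natAdd] at hij
          omega
        | right j => exact hanti' i j (by simpa using hij)

theorem coeff_ordSum_s12 (r s : ℕ) (hr : 1 ≤ r) (u t : Fin (r + s) → ℕ) (N : ℕ) :
    PowerSeries.coeff N (ordSum r s u t) =
      ∑ D ∈ range (N + 1), PowerSeries.coeff N
        (block 0 r (fun i => u (Fin.castAdd s i)) (fun i => t (Fin.castAdd s i)) D *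
          block 1 s (fun i => u (Fin.natAdd r i)) (fun i => t (Fin.natAdd r i)) D) := by
  simp only [PowerSeries.coeff_mul, coeff_block, sum_mul_sum]
  simp only [← sum_product']
  rw [sum_sigma', ordSum, PowerSeries.coeff_mk]
  symm
  refine sum_bij'
    (i := fun y _ => (Fin.append y.2.1.1 y.2.2.1, Fin.append y.2.1.2 y.2.2.2))
    (j := fun p _ => ⟨(∑ i : Fin r, p.2 (Fin.castAdd s i),
        (∑ i : Fin r, p.1 (Fin.castAdd s i) * p.2 (Fin.castAdd s i),
          ∑ i : Fin s, p.1 (Fin.natAdd r i) * p.2 (Fin.natAdd r i))),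
      ((fun i => p.1 (Fin.castAdd s i), fun i => p.2 (Fin.castAdd s i)),
        (fun i => p.1 (Fin.natAdd r i), fun i => p.2 (Fin.natAdd r i)))⟩) ?_ ?_ ?_ ?_ ?_
  · rintro ⟨⟨D, N₁, N₂⟩, ⟨n, d⟩, ⟨n', d'⟩⟩ h
    simp only [mem_sigma, mem_product, mem_range, HasAntidiagonal.mem_antidiagonal,
      mem_chains] at h
    obtain ⟨⟨hD, hN⟩, ⟨hd, -, hanti, hsum, hN₁⟩, ⟨hd', hn', hanti', hsum', hN₂⟩⟩ := h
    rw [mem_ordIndex hr]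
    simp only [Fin.append_left, Fin.append_right, Fin.forall_fin_add]
    exact ⟨⟨hd, hd'⟩, hn', hanti, hanti', by omega, by omega⟩
  · rintro ⟨n, d⟩ h
    rw [mem_ordIndex hr] at h
    obtain ⟨hd, hn', hanti, hanti', hsum, hN⟩ := h
    rw [Fin.forall_fin_add] at hd
    have hle : ∑ i : Fin s, d (Fin.natAdd r i) ≤
        ∑ i : Fin s, n (Fin.natAdd r i) * d (Fin.natAdd r i) :=
      sum_le_sum fun i _ => Nat.le_mul_of_pos_left _ (hn' i)
    simp only [mem_sigma, mem_product, mem_range, HasAntidiagonal.mem_antidiagonal, mem_chains]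
    exact ⟨⟨by simp only at hle hsum hN ⊢; omega, hN⟩, ⟨hd.1, fun _ => Nat.zero_le _, hanti, trivial, trivial⟩,
      hd.2, hn', hanti', hsum.symm, trivial⟩
  · rintro ⟨⟨D, N₁, N₂⟩, ⟨n, d⟩, ⟨n', d'⟩⟩ h
    simp only [mem_sigma, mem_product, mem_chains] at h
    obtain ⟨-, ⟨-, -, -, hsum, hN₁⟩, ⟨-, -, -, -, hN₂⟩⟩ := h
    simp [hsum, hN₁, hN₂]
  · rintro ⟨n, d⟩ h
    exact Prod.ext (Fin.append_castAdd_natAdd) (Fin.append_castAdd_natAdd)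
  · rintro ⟨⟨D, N₁, N₂⟩, ⟨n, d⟩, ⟨n', d'⟩⟩ h
    simp [Fin.prod_univ_add]

/-- The index set of the coefficient of `q^N` in a bi-bracket of length `l` whose first row of
summation variables is bounded by `B`. -/
def bracketIndex (l B N : ℕ) : Finset ((Fin l → ℕ) × (Fin l → ℕ)) :=
  ((Fintype.piFinset fun _ : Fin l => range B) ×ˢ
    (Fintype.piFinset fun _ : Fin l => range (N + 1))).filter
    fun p => (∀ i, 1 ≤ p.1 i) ∧ (∀ i, 1 ≤ p.2 i) ∧
      (∀ i j : Fin l, i < j → p.1 j < p.1 i) ∧ (∑ i, p.1 i * p.2 i) = N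

theorem mem_bracketIndex {l B N : ℕ} {p : (Fin l → ℕ) × (Fin l → ℕ)} :
    p ∈ bracketIndex l B N ↔ (∀ i, p.1 i < B) ∧ (∀ i, 1 ≤ p.1 i) ∧ (∀ i, 1 ≤ p.2 i) ∧
      (∀ i j : Fin l, i < j → p.1 j < p.1 i) ∧ (∑ i, p.1 i * p.2 i) = N := by
  simp only [bracketIndex, mem_filter, mem_product, Fintype.mem_piFinset, mem_range, and_assoc,
    Nat.lt_succ_iff]
  refine and_congr_right fun _ => and_iff_right_of_imp ?_
  rintro ⟨h1, -, -, h5⟩ i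
  rw [← h5]
  exact (Nat.le_mul_of_pos_left _ (h1 i)).trans
    (single_le_sum (f := fun i => p.1 i * p.2 i) (fun _ _ => Nat.zero_le _) (mem_univ i))

theorem sum_bracketIndex_succ (l B N : ℕ) (g : (Fin (l + 1) → ℕ) → (Fin (l + 1) → ℕ) → ℚ) :
    ∑ p ∈ bracketIndex (l + 1) B N, g p.1 p.2 =
      ∑ x ∈ (Ico 1 B ×ˢ range (N + 1)).filter (fun x => 1 ≤ x.2 ∧ x.2 * x.1 ≤ N),
        ∑ p ∈ bracketIndex l x.1 (N - x.2 * x.1), g (Fin.cons x.1 p.1) (Fin.cons x.2 p.2) := by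
  rw [sum_sigma']
  symm
  refine sum_bij'
    (i := fun y _ => ((Fin.cons y.1.1 y.2.1 : Fin (l + 1) → ℕ),
      (Fin.cons y.1.2 y.2.2 : Fin (l + 1) → ℕ)))
    (j := fun p _ => ⟨(p.1 0, p.2 0), (Fin.tail p.1, Fin.tail p.2)⟩) ?_ ?_ ?_ ?_ ?_
  · rintro ⟨⟨a, b⟩, n, m⟩ h
    simp only [mem_sigma, mem_filter, mem_product, mem_range, mem_Ico, mem_bracketIndex] at h
    obtain ⟨⟨⟨ha, -⟩, hb, hle⟩, hlt, hn, hm, hanti, hN⟩ := h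
    rw [mem_bracketIndex]
    refine ⟨?_, ?_, ?_, ?_, ?_⟩
    · exact Fin.cases (by simpa using ha.2) fun i => by simpa using (hlt i).trans ha.2
    · exact Fin.cases (by simpa using ha.1) fun i => by simpa using hn i
    · exact Fin.cases (by simpa using hb) fun i => by simpa using hm i
    · intro i j hij
      induction j using Fin.cases with
      | zero => exact absurd hij (Fin.not_lt_zero i)
      | succ j =>
        induction i using Fin.cases with
        | zero => simpa using hlt j
        | succ i => simpa using hanti i j (by simpa using hij)
    · simp only [Fin.sum_univ_succ, Fin.cons_zero, Fin.cons_succ, hN, mul_comm a b]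
      omega
  · rintro ⟨n, m⟩ h
    rw [mem_bracketIndex] at h
    obtain ⟨hlt, hn, hm, hanti, hN⟩ := h
    simp only [Fin.sum_univ_succ, mul_comm (n 0)] at hN hlt hn hm hanti
    have := Nat.le_mul_of_pos_right (m 0) (hn 0)
    simp only [mem_sigma, mem_filter, mem_product, mem_range, mem_Ico, mem_bracketIndex]
    refine ⟨⟨⟨⟨hn 0, hlt 0⟩, by omega⟩, hm 0, by omega⟩, fun i => hanti 0 i.succ (Fin.succ_pos i),
      fun i => hn _, fun i => hm _, fun i j hij => hanti _ _ (by simpa using hij), ?_⟩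
    simp only [Fin.tail]
    omega
  · rintro ⟨⟨a, b⟩, n, m⟩ h
    simp
  · rintro ⟨n, m⟩ h
    simp
  · intros
    rfl

theorem bracketIndex_zero (B N : ℕ) : bracketIndex 0 B N = if N = 0 then univ else ∅ := by
  ext p
  rw [mem_bracketIndex]
  split_ifs with h
  · simp [h]
  · simpa [eq_comm] using h

theorem coeff_wordSum : ∀ (L : List (ℕ × ℕ)) (B N : ℕ),
    PowerSeries.coeff N (wordSum L B) = ∑ p ∈ bracketIndex L.length B N,
      ∏ i, (p.1 i : ℚ) ^ (L.get i).1 * (p.2 i : ℚ) ^ (L.get i).2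
  | [], B, N => by
    by_cases hN : N = 0 <;> simp [wordSum, bracketIndex_zero, hN, PowerSeries.coeff_one]
  | x :: L, B, N => by
    refine Eq.trans ?_ (sum_bracketIndex_succ L.length B N
      (fun n m => ∏ i, (n i : ℚ) ^ ((x :: L).get i).1 * (m i : ℚ) ^ ((x :: L).get i).2)).symm
    rw [sum_filter, sum_product, wordSum, sumBelow_apply, map_sum]
    refine sum_congr rfl fun k hk => ?_
    rw [Pi.mul_apply, letter, smul_mul_assoc, map_smul, coeff_dilate_mul (mem_Ico.1 hk).1,
      smul_eq_mul, mul_sum]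
    refine sum_congr rfl fun m _ => ?_
    by_cases h : m * k ≤ N
    · by_cases hm : 1 ≤ m
      · simp only [h, hm, powFrom, if_true, and_self, coeff_wordSum L k, mul_sum,
          Fin.prod_univ_succ, Fin.cons_zero, Fin.cons_succ]
        refine sum_congr rfl fun p _ => ?_
        simp [mul_assoc]
      · simp [hm, powFrom]
    · simp [h]

/-- The linear map sending a family `F` to the series whose `N`-th coefficient is that of
`F (N + 1)`. -/
noncomputable def diagonal : (ℕ → PowerSeries ℚ) →ₗ[ℚ] PowerSeries ℚ where
  toFun F := PowerSeries.mk fun N => PowerSeries.coeff N (F (N + 1))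
  map_add' F G := by
    ext N
    simp
  map_smul' c F := by
    ext N
    simp

theorem coeff_diagonal (F : ℕ → PowerSeries ℚ) (N : ℕ) :
    PowerSeries.coeff N (diagonal F) = PowerSeries.coeff N (F (N + 1)) :=
  PowerSeries.coeff_mk N fun N => PowerSeries.coeff N (F (N + 1))

theorem diagonal_wordSum (L : List (ℕ × ℕ)) :
    diagonal (wordSum L) = (∏ i, (((L.get i).1.factorial : ℚ) * ((L.get i).2.factorial : ℚ))) •
      bibracket L.length (fun i => (L.get i).2 + 1) (fun i => (L.get i).1) := by
  ext N
  rw [coeff_diagonal, coeff_wordSum, map_smul, bibracket, PowerSeries.coeff_mk, smul_eq_mul,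
    mul_sum]
  refine sum_congr rfl fun p _ => ?_
  rw [← prod_mul_distrib]
  refine prod_congr rfl fun i _ => ?_
  have h1 : ((L.get i).1.factorial : ℚ) ≠ 0 := Nat.cast_ne_zero.2 (Nat.factorial_ne_zero _)
  have h2 : ((L.get i).2.factorial : ℚ) ≠ 0 := Nat.cast_ne_zero.2 (Nat.factorial_ne_zero _)
  rw [Nat.add_sub_cancel]
  field_simp

theorem weight_eq_sum : ∀ L : List (ℕ × ℕ),
    weight L = ∑ i : Fin L.length, ((L.get i).2 + 1 + (L.get i).1)
  | [] => rfl
  | x :: L => by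
    have := weight_eq_sum L
    rw [weight, this]
    simp only [List.length_cons, Fin.sum_univ_succ]
    simp
    omega

theorem ordSum_mem_span (r s : ℕ) (hr : 1 ≤ r) (hs : 1 ≤ s) (u t : Fin (r + s) → ℕ) :
    ordSum r s u t ∈ Submodule.span ℚ {f | ∃ (x : ℕ × ℕ) (L : List (ℕ × ℕ)), 1 ≤ x.2 ∧
      weight (x :: L) ≤ ∑ i, (u i + t i + 1) ∧ f = bibracket (x :: L).length
        (fun i => ((x :: L).get i).2 + 1) (fun i => ((x :: L).get i).1)} := by
  obtain ⟨r, rfl⟩ : ∃ k, r = k + 1 := ⟨r - 1, by omega⟩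
  obtain ⟨s, rfl⟩ : ∃ k, s = k + 1 := ⟨s - 1, by omega⟩
  obtain ⟨F, hF, hFeq⟩ := exists_headSpan_eq_block r 0
    (fun i => u (Fin.castAdd (s + 1) i)) (fun i => t (Fin.castAdd (s + 1) i))
  obtain ⟨G, hG, hGeq⟩ := exists_headSpan_eq_block s 1
    (fun i => u (Fin.natAdd (r + 1) i)) (fun i => t (Fin.natAdd (r + 1) i))
  have h : ordSum (r + 1) (s + 1) u t = (diagonal ∘ₗ sumBelow) (F * G) := by
    ext N
    rw [coeff_ordSum_s12 _ _ hr, LinearMap.comp_apply, coeff_diagonal, sumBelow_apply, map_sum,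
      range_eq_Ico, sum_eq_sum_Ico_succ_bot (Nat.succ_pos N), block_succ_zero, zero_mul, map_zero,
      zero_add]
    refine sum_congr rfl fun D hD => ?_
    rw [hFeq D (mem_Ico.1 hD).1, hGeq D (mem_Ico.1 hD).1, Pi.mul_apply]
  have hmem := Submodule.mem_map_of_mem (f := diagonal ∘ₗ sumBelow) (headSpan_mul_headSpan hF hG)
  rw [← h, headSpan, Submodule.map_span] at hmem
  refine Submodule.span_le.2 ?_ hmem
  rintro _ ⟨_, ⟨x, L, hx, hw, rfl⟩, rfl⟩
  rw [LinearMap.comp_apply, ← wordSum, diagonal_wordSum]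
  refine Submodule.smul_mem _ _ (Submodule.subset_span ⟨x, L, hx, ?_, rfl⟩)
  rwa [Fin.sum_univ_add]

/-- Lemma 4.3: the ordered sum is a finite ℚ-linear combination of
bi-brackets of weight at most ∑(uᵢ+tᵢ+1), with first upper index ≥ 2 when all tᵢ ≥ 1. -/
theorem stmt12 (r s : ℕ) (hr : 1 ≤ r) (hs : 1 ≤ s) (u t : Fin (r + s) → ℕ) :
    ∃ (K : ℕ) (c : Fin K → ℚ) (l : Fin K → ℕ)
      (s' : (κ : Fin K) → Fin (l κ) → ℕ) (r' : (κ : Fin K) → Fin (l κ) → ℕ),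
      ordSum r s u t = ∑ κ, c κ • bibracket (l κ) (s' κ) (r' κ) ∧
      (∀ κ i, 1 ≤ s' κ i) ∧
      (∀ κ, (∑ i, (s' κ i + r' κ i)) ≤ ∑ i, (u i + t i + 1)) ∧
      ((∀ i, 1 ≤ t i) → ∀ κ (h : 0 < l κ), 2 ≤ s' κ ⟨0, h⟩) := by
  obtain ⟨K, c, g, hg⟩ := Submodule.mem_span_set'.1 (ordSum_mem_span r s hr hs u t)
  choose x L hx hw hb using fun κ => (g κ).2
  refine ⟨K, c, fun κ => (x κ :: L κ).length, fun κ i => ((x κ :: L κ).get i).2 + 1,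
    fun κ i => ((x κ :: L κ).get i).1, ?_, fun κ i => Nat.le_add_left 1 _, fun κ => ?_,
    fun _ κ _ => Nat.succ_le_succ (hx κ)⟩
  · rw [← hg]
    exact sum_congr rfl fun κ _ => by rw [hb κ]
  · exact (weight_eq_sum (x κ :: L κ)).symm.trans_le (hw κ)
end
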